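/- arXiv:1901.08218 — 4 statements merged into one kernel-verified Lean document; each statement's English description precedes it below -/
import Mathlib

section
/- Let Ū : (−1,1) → ℝ be continuous and suppose there exist constants u₋, u₊ ∈ ℝ, α ∈ (0,1] and C₀ > 0 such that |Ū(x) − u₋| ≤ C₀(1+x)^α for all x ∈ (−1,0] and |Ū(x) − u₊| ≤ C₀(1−x)^α for all x ∈ [0,1). Then there exists a constant C > 0 such that for all x ∈ (−1,1): e^{b(x)} ≤ C(1+x)^{u₋/2}(1−x)^{−u₊/2}, e^{−b(x)} ≤ C(1+x)^{−u₋/2}(1−x)^{u₊/2}, e^{a(x)} ≤ C(1+x)^{u₋/2−1}(1−x)^{−1−u₊/2}, and e^{−a(x)} ≤ C(1+x)^{1−u₋/2}(1−x)^{1+u₊/2}. -/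
open Set Filter

/-- `a(x) = ∫₀ˣ (2s + Ū(s))/(1−s²) ds`. -/
noncomputable def aF (U : ℝ → ℝ) (x : ℝ) : ℝ := ∫ s in (0:ℝ)..x, (2*s + U s) / (1 - s^2)

/-- `b(x) = ∫₀ˣ Ū(s)/(1−s²) ds`. -/
noncomputable def bF (U : ℝ → ℝ) (x : ℝ) : ℝ := ∫ s in (0:ℝ)..x, U s / (1 - s^2)

theorem hasDerivAt_bF {V : ℝ → ℝ} (hV : ContinuousOn V (Ioo (-1 : ℝ) 1)) {x : ℝ}
    (hx : x ∈ Ioo (-1 : ℝ) 1) : HasDerivAt (bF V) (V x / (1 - x ^ 2)) x := by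
  have hc : ContinuousOn (fun s => V s / (1 - s ^ 2)) (Ioo (-1 : ℝ) 1) :=
    hV.div (by fun_prop) fun s hs => by nlinarith [hs.1, hs.2]
  have hsub : uIcc 0 x ⊆ Ioo (-1 : ℝ) 1 :=
    ordConnected_Ioo.uIcc_subset (by norm_num) hx
  exact intervalIntegral.integral_hasDerivAt_right (hc.mono hsub).intervalIntegrable
    (hc.stronglyMeasurableAtFilter isOpen_Ioo x hx) (hc.continuousAt (isOpen_Ioo.mem_nhds hx))

theorem bF_zero (V : ℝ → ℝ) : bF V 0 = 0 := by simp [bF]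

/-- Reflecting the integrand about the origin reflects its primitive. -/
theorem bF_neg_comp_neg (V : ℝ → ℝ) (x : ℝ) : bF (fun s => -V (-s)) x = bF V (-x) := by
  have h := intervalIntegral.integral_comp_neg (a := 0) (b := x) (fun s => V s / (1 - s ^ 2))
  rw [neg_zero, intervalIntegral.integral_symm 0 (-x)] at h
  simp only [neg_sq] at h
  simp only [bF, neg_div, intervalIntegral.integral_neg, h, neg_neg]

/-- The primitive `bF V` differs from its logarithmic model by a bounded amount on `[0, 1)`. -/
theorem abs_bF_sub_log_le {V : ℝ → ℝ} (hV : ContinuousOn V (Ioo (-1 : ℝ) 1)) {p α C : ℝ}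
    (q : ℝ) (hα : 0 < α) (hC : 0 ≤ C)
    (h : ∀ x ∈ Ico (0 : ℝ) 1, |V x - p| ≤ C * (1 - x) ^ α) {x : ℝ} (hx : x ∈ Ico (0 : ℝ) 1) :
    |bF V x + p / 2 * Real.log (1 - x) - q / 2 * Real.log (1 + x)| ≤ C / α + |p - q| / 2 := by
  have hd : ∀ y ∈ Icc 0 x, HasDerivAt
      (fun y => bF V y + p / 2 * Real.log (1 - y) - q / 2 * Real.log (1 + y))
      (V y / (1 - y ^ 2) + p / 2 * (-1 / (1 - y)) - q / 2 * (1 / (1 + y))) y := fun y hy => by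
    have h1 : 1 - y ≠ 0 := by linarith [hy.2, hx.2]
    have h2 : 1 + y ≠ 0 := by linarith [hy.1]
    exact ((hasDerivAt_bF hV ⟨by linarith [hy.1], hy.2.trans_lt hx.2⟩).add
      ((((hasDerivAt_id y).const_sub 1).log h1).const_mul _)).sub
      ((((hasDerivAt_id y).const_add 1).log h2).const_mul _)
  have hB : ∀ y ∈ Icc 0 x, HasDerivAt
      (fun y => C / α * (1 - (1 - y) ^ α) + |p - q| / 2 * y)
      (C * (1 - y) ^ (α - 1) + |p - q| / 2) y := fun y hy => by
    have h1 : 1 - y ≠ 0 := by linarith [hy.2, hx.2]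
    have e : C * (1 - y) ^ (α - 1) + |p - q| / 2
        = C / α * -(-1 * α * (1 - y) ^ (α - 1)) + |p - q| / 2 * 1 := by
      field_simp
    rw [e]
    exact (((((hasDerivAt_id y).const_sub 1).rpow_const (p := α) (Or.inl h1)).const_sub
      1).const_mul (C / α)).add ((hasDerivAt_id y).const_mul (|p - q| / 2))
  have key := image_norm_le_of_norm_deriv_right_le_deriv_boundary'
    (fun y hy => (hd y hy).continuousAt.continuousWithinAt)
    (fun y hy => (hd y (Ico_subset_Icc_self hy)).hasDerivWithinAt)
    (by simp [bF_zero])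
    (fun y hy => (hB y hy).continuousAt.continuousWithinAt)
    (fun y hy => (hB y (Ico_subset_Icc_self hy)).hasDerivWithinAt)
    (fun y hy => ?_) (right_mem_Icc.2 hx.1)
  · rw [Real.norm_eq_abs] at key
    refine key.trans ?_
    have h1 : 0 ≤ C / α * (1 - x) ^ α :=
      mul_nonneg (div_nonneg hC hα.le) (Real.rpow_nonneg (by linarith [hx.2]) _)
    have h2 : |p - q| / 2 * x ≤ |p - q| / 2 :=
      mul_le_of_le_one_right (by positivity) hx.2.le
    linarith
  · have h1 : 0 < 1 - y := by linarith [hy.2, hx.2]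
    have h2 : 1 ≤ 1 + y := by linarith [hy.1]
    have h3 : 0 < 1 + y := by linarith
    have h4 : 1 - y ^ 2 = (1 - y) * (1 + y) := by ring
    have e : V y / (1 - y ^ 2) + p / 2 * (-1 / (1 - y)) - q / 2 * (1 / (1 + y))
        = (V y - p) / (1 - y) / (1 + y) + (p - q) / 2 / (1 + y) := by
      rw [h4]
      field_simp
      ring
    rw [e, Real.norm_eq_abs, Real.rpow_sub_one h1.ne']
    refine (abs_add_le _ _).trans (add_le_add ?_ ?_)
    · rw [abs_div, abs_div, abs_of_pos h1, abs_of_pos h3, ← mul_div_assoc]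
      exact (div_le_self (by positivity) h2).trans
        (div_le_div_of_nonneg_right (h y ⟨hy.1, hy.2.trans hx.2⟩) h1.le)
    · rw [abs_div, abs_div, abs_of_pos h3, abs_two]
      exact div_le_self (by positivity) h2

theorem exp_bF_bounds {V : ℝ → ℝ} (hV : ContinuousOn V (Ioo (-1 : ℝ) 1)) {vm vp α C : ℝ}
    (hα : 0 < α) (hC : 0 ≤ C)
    (hm : ∀ x ∈ Ioc (-1 : ℝ) 0, |V x - vm| ≤ C * (1 + x) ^ α)
    (hp : ∀ x ∈ Ico (0 : ℝ) 1, |V x - vp| ≤ C * (1 - x) ^ α) :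
    ∃ K > 0, ∀ x ∈ Ioo (-1 : ℝ) 1,
      Real.exp (bF V x) ≤ K * (1 + x) ^ (vm / 2) * (1 - x) ^ (-(vp / 2)) ∧
      Real.exp (-(bF V x)) ≤ K * (1 + x) ^ (-(vm / 2)) * (1 - x) ^ (vp / 2) := by
  refine ⟨Real.exp (C / α + |vp - vm| / 2), Real.exp_pos _, fun x hx => ?_⟩
  have key : |bF V x + vp / 2 * Real.log (1 - x) - vm / 2 * Real.log (1 + x)|
      ≤ C / α + |vp - vm| / 2 := by
    rcases le_total 0 x with h0 | h0
    · exact abs_bF_sub_log_le hV vm hα hC hp ⟨h0, hx.2⟩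
    · have hW : ContinuousOn (fun s => -V (-s)) (Ioo (-1 : ℝ) 1) :=
        (hV.comp continuousOn_neg fun s hs => ⟨by linarith [hs.2], by linarith [hs.1]⟩).neg
      have hWp : ∀ y ∈ Ico (0 : ℝ) 1, |-V (-y) - -vm| ≤ C * (1 - y) ^ α := fun y hy => by
        rw [← neg_sub', abs_neg, sub_eq_add_neg 1 y]
        exact hm (-y) ⟨by linarith [hy.2], by linarith [hy.1]⟩
      have h := abs_bF_sub_log_le hW (-vp) hα hC hWp (x := -x) ⟨by linarith, by linarith [hx.1]⟩
      rw [bF_neg_comp_neg, neg_neg, sub_neg_eq_add, ← sub_eq_add_neg,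
        show -vm - -vp = vp - vm by ring] at h
      convert h using 2
      ring
  have h1 : 0 < 1 + x := by linarith [hx.1]
  have h2 : 0 < 1 - x := by linarith [hx.2]
  obtain ⟨k1, k2⟩ := abs_le.1 key
  simp only [Real.rpow_def_of_pos h1, Real.rpow_def_of_pos h2, ← Real.exp_add, Real.exp_le_exp]
  constructor <;> linarith

/-- exponential bounds on `e^{±a}`, `e^{±b}` when `Ū` has power-rate limits
`u₋` at `−1` and `u₊` at `1`. -/
theorem stmt0 (U : ℝ → ℝ) (hU : ContinuousOn U (Ioo (-1:ℝ) 1))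
    (um up α C₀ : ℝ) (hα : 0 < α) (hα1 : α ≤ 1) (hC₀ : 0 < C₀)
    (hminus : ∀ x ∈ Ioc (-1:ℝ) 0, |U x - um| ≤ C₀ * (1+x) ^ α)
    (hplus : ∀ x ∈ Ico (0:ℝ) 1, |U x - up| ≤ C₀ * (1-x) ^ α) :
    ∃ C > 0, ∀ x ∈ Ioo (-1:ℝ) 1,
      Real.exp (bF U x) ≤ C * (1+x) ^ (um/2) * (1-x) ^ (-(up/2)) ∧
      Real.exp (-(bF U x)) ≤ C * (1+x) ^ (-(um/2)) * (1-x) ^ (up/2) ∧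
      Real.exp (aF U x) ≤ C * (1+x) ^ (um/2 - 1) * (1-x) ^ (-1 - up/2) ∧
      Real.exp (-(aF U x)) ≤ C * (1+x) ^ (1 - um/2) * (1-x) ^ (1 + up/2) := by
  obtain ⟨K, hK, hb⟩ := exp_bF_bounds hU hα hC₀.le hminus hplus
  have hlin : ∀ t : ℝ, 0 < t → t ≤ 1 → t ≤ t ^ α := fun t h0 h1 => by
    simpa using Real.rpow_le_rpow_of_exponent_ge h0 h1 hα1
  have hm : ∀ x ∈ Ioc (-1 : ℝ) 0, |2 * x + U x - (um - 2)| ≤ (C₀ + 2) * (1 + x) ^ α :=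
    fun x hx => by
      have h1 := abs_le.1 (hminus x hx)
      have h2 := hlin (1 + x) (by linarith [hx.1]) (by linarith [hx.2])
      rw [abs_le]
      constructor <;> linarith [hx.1]
  have hp : ∀ x ∈ Ico (0 : ℝ) 1, |2 * x + U x - (up + 2)| ≤ (C₀ + 2) * (1 - x) ^ α :=
    fun x hx => by
      have h1 := abs_le.1 (hplus x hx)
      have h2 := hlin (1 - x) (by linarith [hx.2]) (by linarith [hx.1])
      rw [abs_le]
      constructor <;> linarith [hx.2]
  have hV : ContinuousOn (fun s => 2 * s + U s) (Ioo (-1 : ℝ) 1) :=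
    (by fun_prop : ContinuousOn (fun s : ℝ => 2 * s) _).add hU
  obtain ⟨L, hL, ha⟩ := exp_bF_bounds hV hα (by linarith : (0 : ℝ) ≤ C₀ + 2) hm hp
  refine ⟨max K L, lt_max_of_lt_left hK, fun x hx => ?_⟩
  have mono : ∀ {M : ℝ} (r s : ℝ), M ≤ max K L →
      M * (1 + x) ^ r * (1 - x) ^ s ≤ max K L * (1 + x) ^ r * (1 - x) ^ s := fun r s hM =>
    mul_le_mul_of_nonneg_right
      (mul_le_mul_of_nonneg_right hM (Real.rpow_nonneg (by linarith [hx.1]) _))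
      (Real.rpow_nonneg (by linarith [hx.2]) _)
  obtain ⟨b1, b2⟩ := hb x hx
  obtain ⟨a1, a2⟩ := ha x hx
  rw [show (um - 2) / 2 = um / 2 - 1 by ring, show -((up + 2) / 2) = -1 - up / 2 by ring] at a1
  rw [show -((um - 2) / 2) = 1 - um / 2 by ring, show (up + 2) / 2 = 1 + up / 2 by ring] at a2
  exact ⟨b1.trans (mono _ _ (le_max_left _ _)), b2.trans (mono _ _ (le_max_left _ _)),
    a1.trans (mono _ _ (le_max_right _ _)), a2.trans (mono _ _ (le_max_right _ _))⟩
end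

section
/- Let Ū : (−1,1) → ℝ be continuous and suppose there exists C₀ > 0 such that |Ū(x) − 2 − 4/ln((1+x)/3)| ≤ C₀(ln((1+x)/3))^{−2} for all x ∈ (−1,0] and |Ū(x) + 2 + 4/ln((1−x)/3)| ≤ C₀(ln((1−x)/3))^{−2} for all x ∈ [0,1). Then there exists a constant C > 0 such that for all x ∈ (−1,1): e^{b(x)} ≤ C(ln((1+x)/3))²(ln((1−x)/3))²(1−x²), e^{−b(x)} ≤ C(ln((1+x)/3))^{−2}(ln((1−x)/3))^{−2}(1−x²)^{−1}, e^{a(x)} ≤ C(ln((1+x)/3))²(ln((1−x)/3))², and e^{−a(x)} ≤ C(ln((1+x)/3))^{−2}(ln((1−x)/3))^{−2}. -/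
open Set Filter

theorem hasDerivAt_integral_of_continuousOn_Ioo {f : ℝ → ℝ} {l r c x : ℝ}
    (hf : ContinuousOn f (Ioo l r)) (hc : c ∈ Ioo l r) (hx : x ∈ Ioo l r) :
    HasDerivAt (fun y => ∫ s in c..y, f s) (f x) x := by
  have hsub : uIcc c x ⊆ Ioo l r := ordConnected_Ioo.uIcc_subset hc hx
  exact intervalIntegral.integral_hasDerivAt_right (hf.mono hsub).intervalIntegrable
    (hf.stronglyMeasurableAtFilter isOpen_Ioo x hx) (hf.continuousAt (isOpen_Ioo.mem_nhds hx))

theorem abs_sub_le_of_abs_deriv_le_deriv {D H D' H' : ℝ → ℝ} {s : Set ℝ} (hs : Convex ℝ s)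
    (hD : ∀ x ∈ s, HasDerivAt D (D' x) x) (hH : ∀ x ∈ s, HasDerivAt H (H' x) x)
    (hle : ∀ x ∈ s, |D' x| ≤ H' x) {x y : ℝ} (hx : x ∈ s) (hy : y ∈ s) :
    |D x - D y| ≤ |H x - H y| := by
  have hadd : MonotoneOn (fun z => H z + D z) s :=
    monotoneOn_of_hasDerivWithinAt_nonneg hs
      (fun z hz => ((hH z hz).add (hD z hz)).continuousAt.continuousWithinAt)
      (fun z hz => ((hH z (interior_subset hz)).add
        (hD z (interior_subset hz))).hasDerivWithinAt)
      (fun z hz => by linarith [(abs_le.mp (hle z (interior_subset hz))).1])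
  have hsub : MonotoneOn (fun z => H z - D z) s :=
    monotoneOn_of_hasDerivWithinAt_nonneg hs
      (fun z hz => ((hH z hz).sub (hD z hz)).continuousAt.continuousWithinAt)
      (fun z hz => ((hH z (interior_subset hz)).sub
        (hD z (interior_subset hz))).hasDerivWithinAt)
      (fun z hz => by linarith [(abs_le.mp (hle z (interior_subset hz))).2])
  rcases le_total x y with h | h
  · have h1 := hadd hx hy h
    have h2 := hsub hx hy h
    simp only at h1 h2
    rw [abs_le, abs_of_nonpos (by linarith : H x - H y ≤ 0)]
    constructor <;> linarith
  · have h1 := hadd hy hx h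
    have h2 := hsub hy hx h
    simp only at h1 h2
    rw [abs_le, abs_of_nonneg (by linarith : 0 ≤ H x - H y)]
    constructor <;> linarith

theorem log_div_three_le {t : ℝ} (ht₀ : 0 < t) (ht₂ : t < 2) : Real.log (t / 3) ≤ -(1 / 3) := by
  linarith [Real.log_le_sub_one_of_pos (by positivity : 0 < t / 3)]

theorem hasDerivAt_log_add_div_three {x : ℝ} (hx : -1 < x) :
    HasDerivAt (fun y : ℝ => Real.log ((1 + y) / 3)) (1 / (1 + x)) x := by
  have h : HasDerivAt (fun y : ℝ => (1 + y) / 3) (1 / 3) x :=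
    ((hasDerivAt_id x).const_add 1).div_const 3
  have hne : 1 + x ≠ 0 := by linarith
  convert h.log (by positivity) using 1
  field_simp

theorem hasDerivAt_log_sub_div_three {x : ℝ} (hx : x < 1) :
    HasDerivAt (fun y : ℝ => Real.log ((1 - y) / 3)) (-1 / (1 - x)) x := by
  have h : HasDerivAt (fun y : ℝ => (1 - y) / 3) (-1 / 3) x :=
    ((hasDerivAt_id x).const_sub 1).div_const 3
  have hne : 1 - x ≠ 0 := by linarith
  convert h.log (by positivity) using 1
  field_simp

/-- With `P = ln((1+x)/3)` and `Q = ln((1-x)/3)`, the function `u / (1 - x²)` agrees with the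
derivative of `ln((1 - x²) P² Q²)` up to an error that is integrable near `-1`. -/
theorem abs_div_sub_logDeriv_le {x u P Q c : ℝ} (hx : x ∈ Ioc (-1 : ℝ) 0)
    (hP : P ≤ -(1 / 3)) (hQ : Q ≤ -(1 / 3)) (hc : 0 ≤ c) (hu : |u - 2 - 4 / P| ≤ c / P ^ 2) :
    |(2 * x + u) / (1 - x ^ 2) - 2 / (P * (1 + x)) + 2 / (Q * (1 - x))| ≤
      14 + c / (P ^ 2 * (1 + x)) := by
  obtain ⟨hx₁, hx₀⟩ := hx
  have hp : 0 < 1 + x := by linarith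
  have hm : 1 ≤ 1 - x := by linarith
  have hm' : 0 < 1 - x := by linarith
  have hPne : P ≠ 0 := by linarith
  have hQne : Q ≠ 0 := by linarith
  have hsq : 1 - x ^ 2 = (1 + x) * (1 - x) := by ring
  have hsplit : (2 * x + u) / (1 - x ^ 2) - 2 / (P * (1 + x)) + 2 / (Q * (1 - x)) =
      2 / (1 - x) + 2 / (P * (1 - x)) + 2 / (Q * (1 - x)) +
        (u - 2 - 4 / P) / ((1 + x) * (1 - x)) := by
    rw [hsq]
    field_simp
    ring
  have key : ∀ R : ℝ, R ≤ -(1 / 3) → |2 / (R * (1 - x))| ≤ 6 := by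
    intro R hR
    rw [abs_div, abs_mul, abs_of_nonpos (by linarith : R ≤ 0), abs_of_pos hm', abs_two,
      div_le_iff₀ (by nlinarith)]
    nlinarith
  have h1 : |2 / (1 - x)| ≤ 2 := by
    rw [abs_div, abs_two, abs_of_pos hm', div_le_iff₀ hm']
    linarith
  have h4 : |(u - 2 - 4 / P) / ((1 + x) * (1 - x))| ≤ c / (P ^ 2 * (1 + x)) := by
    rw [abs_div, abs_of_pos (mul_pos hp hm'), ← div_div c]
    refine div_le_div₀ (by positivity) hu hp ?_
    nlinarith
  rw [hsplit]
  refine (abs_add_le _ _).trans (add_le_add ((abs_add_le _ _).trans ?_) h4)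
  linarith [abs_add_le (2 / (1 - x)) (2 / (P * (1 - x))), key P hP, key Q hQ]

theorem exp_le_and_exp_neg_le {t E M : ℝ} (hE : 0 < E) (h : |t - Real.log E| ≤ M) :
    Real.exp t ≤ Real.exp M * E ∧ Real.exp (-t) ≤ Real.exp M / E := by
  obtain ⟨h1, h2⟩ := abs_le.mp h
  rw [← Real.exp_log hE, ← Real.exp_add, ← Real.exp_sub, Real.exp_le_exp, Real.exp_le_exp]
  constructor <;> linarith

/-- exponential bounds on `e^{±a}`, `e^{±b}` when `Ū` has logarithmic
asymptotics `2 + 4/ln((1+x)/3)` at `−1` and `−2 − 4/ln((1−x)/3)` at `1`. -/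
theorem stmt2 (U : ℝ → ℝ) (hU : ContinuousOn U (Ioo (-1:ℝ) 1))
    (C₀ : ℝ) (hC₀ : 0 < C₀)
    (hminus : ∀ x ∈ Ioc (-1:ℝ) 0,
      |U x - 2 - 4 / Real.log ((1+x)/3)| ≤ C₀ / (Real.log ((1+x)/3))^2)
    (hplus : ∀ x ∈ Ico (0:ℝ) 1,
      |U x + 2 + 4 / Real.log ((1-x)/3)| ≤ C₀ / (Real.log ((1-x)/3))^2) :
    ∃ C > 0, ∀ x ∈ Ioo (-1:ℝ) 1,
      Real.exp (bF U x) ≤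
        C * (Real.log ((1+x)/3))^2 * (Real.log ((1-x)/3))^2 * (1-x^2) ∧
      Real.exp (-(bF U x)) ≤
        C / ((Real.log ((1+x)/3))^2 * (Real.log ((1-x)/3))^2 * (1-x^2)) ∧
      Real.exp (aF U x) ≤ C * (Real.log ((1+x)/3))^2 * (Real.log ((1-x)/3))^2 ∧
      Real.exp (-(aF U x)) ≤ C / ((Real.log ((1+x)/3))^2 * (Real.log ((1-x)/3))^2) := by
  set P : ℝ → ℝ := fun x => Real.log ((1 + x) / 3) with hPdef
  set Q : ℝ → ℝ := fun x => Real.log ((1 - x) / 3) with hQdef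
  have hP : ∀ x ∈ Ioo (-1 : ℝ) 1, P x ≤ -(1 / 3) := fun x hx =>
    log_div_three_le (by linarith [hx.1]) (by linarith [hx.2])
  have hQ : ∀ x ∈ Ioo (-1 : ℝ) 1, Q x ≤ -(1 / 3) := fun x hx =>
    log_div_three_le (by linarith [hx.2]) (by linarith [hx.1])
  have hPne : ∀ x ∈ Ioo (-1 : ℝ) 1, P x ≠ 0 := fun x hx => by linarith [hP x hx]
  have hQne : ∀ x ∈ Ioo (-1 : ℝ) 1, Q x ≠ 0 := fun x hx => by linarith [hQ x hx]
  have hsq : ∀ x ∈ Ioo (-1 : ℝ) 1, 0 < 1 - x ^ 2 := fun x hx => by nlinarith [hx.1, hx.2]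
  have hdP : ∀ x ∈ Ioo (-1 : ℝ) 1, HasDerivAt P (1 / (1 + x)) x := fun x hx =>
    hasDerivAt_log_add_div_three hx.1
  have hdQ : ∀ x ∈ Ioo (-1 : ℝ) 1, HasDerivAt Q (-1 / (1 - x)) x := fun x hx =>
    hasDerivAt_log_sub_div_three hx.2
  have h0 : (0 : ℝ) ∈ Ioo (-1 : ℝ) 1 := by norm_num
  set d : ℝ → ℝ := fun x =>
    (2 * x + U x) / (1 - x ^ 2) - 2 / (P x * (1 + x)) + 2 / (Q x * (1 - x)) with hd
  set A : ℝ → ℝ := fun x => aF U x - Real.log (P x ^ 2 * Q x ^ 2)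
  set B : ℝ → ℝ := fun x => bF U x - Real.log (P x ^ 2 * Q x ^ 2 * (1 - x ^ 2)) with hB
  set H : ℝ → ℝ := fun x => 14 * x - C₀ / P x + C₀ / Q x with hH
  have hdW : ∀ x ∈ Ioo (-1 : ℝ) 1, HasDerivAt (fun x => Real.log (P x ^ 2 * Q x ^ 2))
      (2 / (P x * (1 + x)) - 2 / (Q x * (1 - x))) x := by
    intro x hx
    have hPx := hPne x hx
    have hQx := hQne x hx
    have hp : 1 + x ≠ 0 := by linarith [hx.1]
    have hm : 1 - x ≠ 0 := by linarith [hx.2]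
    refine ((((hdP x hx).pow 2).mul ((hdQ x hx).pow 2)).log (by simp [hPx, hQx])).congr_deriv ?_
    simp only [Pi.mul_apply, Pi.pow_apply]
    field_simp
    ring
  have hdA : ∀ x ∈ Ioo (-1 : ℝ) 1, HasDerivAt A (d x) x := by
    intro x hx
    have hc : ContinuousOn (fun s => (2 * s + U s) / (1 - s ^ 2)) (Ioo (-1) 1) :=
      ((by fun_prop : ContinuousOn (fun s : ℝ => 2 * s) (Ioo (-1) 1)).add hU).div
        (by fun_prop) fun s hs => (hsq s hs).ne'
    refine ((hasDerivAt_integral_of_continuousOn_Ioo hc h0 hx).sub (hdW x hx)).congr_deriv ?_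
    simp only [hd]
    ring
  have hdB : ∀ x ∈ Ioo (-1 : ℝ) 1, HasDerivAt B (d x) x := by
    intro x hx
    have hc : ContinuousOn (fun s => U s / (1 - s ^ 2)) (Ioo (-1) 1) :=
      hU.div (by fun_prop) fun s hs => (hsq s hs).ne'
    have hl : HasDerivAt (fun y : ℝ => Real.log (1 - y ^ 2)) (-(2 * x) / (1 - x ^ 2)) x := by
      refine (((hasDerivAt_pow 2 x).const_sub 1).log (hsq x hx).ne').congr_deriv ?_
      norm_num
    have h := ((hasDerivAt_integral_of_continuousOn_Ioo hc h0 hx).sub (hdW x hx)).sub hl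
    have hEq : B =ᶠ[nhds x] fun y => (∫ s in (0:ℝ)..y, U s / (1 - s ^ 2)) -
        Real.log (P y ^ 2 * Q y ^ 2) - Real.log (1 - y ^ 2) := by
      filter_upwards [isOpen_Ioo.mem_nhds hx] with y hy
      simp only [hB, bF]
      rw [Real.log_mul (by simp [hPne y hy, hQne y hy]) (hsq y hy).ne']
      ring
    refine (h.congr_of_eventuallyEq hEq).congr_deriv ?_
    simp only [hd]
    ring
  have hdH : ∀ x ∈ Ioo (-1 : ℝ) 1, HasDerivAt H
      (14 + C₀ / (P x ^ 2 * (1 + x)) + C₀ / (Q x ^ 2 * (1 - x))) x := by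
    intro x hx
    have hPx := hPne x hx
    have hQx := hQne x hx
    have hp : 1 + x ≠ 0 := by linarith [hx.1]
    have hm : 1 - x ≠ 0 := by linarith [hx.2]
    refine ((((hasDerivAt_id x).const_mul 14).sub
      ((hasDerivAt_const x C₀).div (hdP x hx) hPx)).add
      ((hasDerivAt_const x C₀).div (hdQ x hx) hQx)).congr_deriv ?_
    field_simp
    ring
  have hle : ∀ x ∈ Ioo (-1 : ℝ) 1,
      |d x| ≤ 14 + C₀ / (P x ^ 2 * (1 + x)) + C₀ / (Q x ^ 2 * (1 - x)) := by
    intro x hx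
    have hp : 0 < 1 + x := by linarith [hx.1]
    have hm : 0 < 1 - x := by linarith [hx.2]
    have hp' : 0 ≤ C₀ / (P x ^ 2 * (1 + x)) := by positivity
    have hm' : 0 ≤ C₀ / (Q x ^ 2 * (1 - x)) := by positivity
    rcases le_total x 0 with h | h
    · linarith [abs_div_sub_logDeriv_le ⟨hx.1, h⟩ (hP x hx) (hQ x hx) hC₀.le
        (hminus x ⟨hx.1, h⟩)]
    · have hu : |-U x - 2 - 4 / Q x| ≤ C₀ / Q x ^ 2 := by
        rw [← abs_neg]
        convert hplus x ⟨h, hx.2⟩ using 2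
        ring
      have := abs_div_sub_logDeriv_le (x := -x) ⟨by linarith [hx.2], by linarith⟩
        (hQ x hx) (hP x hx) hC₀.le hu
      rw [← abs_neg] at this
      have hdx : -((2 * -x + -U x) / (1 - (-x) ^ 2) - 2 / (Q x * (1 + -x)) +
          2 / (P x * (1 - -x))) = d x := by
        simp only [hd, neg_sq, sub_neg_eq_add, ← sub_eq_add_neg]
        ring
      rw [hdx, ← sub_eq_add_neg] at this
      linarith
  have hinv : ∀ R : ℝ, R ≤ -(1 / 3) → 0 ≤ -(C₀ / R) ∧ -(C₀ / R) ≤ 3 * C₀ := by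
    intro R hR
    rw [← div_neg]
    refine ⟨div_nonneg hC₀.le (by linarith), ?_⟩
    rw [div_le_iff₀ (by linarith)]
    nlinarith
  have hHle : ∀ x ∈ Ioo (-1 : ℝ) 1, |H x - H 0| ≤ 14 + 6 * C₀ := by
    intro x hx
    have hH0 : H 0 = 0 := by simp [hH, hPdef, hQdef]
    obtain ⟨h1, h2⟩ := hinv _ (hP x hx)
    obtain ⟨h3, h4⟩ := hinv _ (hQ x hx)
    rw [hH0, sub_zero, abs_le]
    simp only [hH]
    constructor <;> linarith [hx.1, hx.2]
  set M := 14 + 6 * C₀ + max |A 0| |B 0|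
  have hAM : ∀ x ∈ Ioo (-1 : ℝ) 1, |A x| ≤ M := fun x hx => by
    linarith [abs_sub_le_of_abs_deriv_le_deriv (convex_Ioo _ _) hdA hdH hle hx h0, hHle x hx,
      abs_sub_abs_le_abs_sub (A x) (A 0), le_max_left |A 0| |B 0|]
  have hBM : ∀ x ∈ Ioo (-1 : ℝ) 1, |B x| ≤ M := fun x hx => by
    linarith [abs_sub_le_of_abs_deriv_le_deriv (convex_Ioo _ _) hdB hdH hle hx h0, hHle x hx,
      abs_sub_abs_le_abs_sub (B x) (B 0), le_max_right |A 0| |B 0|]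
  refine ⟨Real.exp M, Real.exp_pos M, fun x hx => ?_⟩
  have hE : 0 < P x ^ 2 * Q x ^ 2 :=
    mul_pos (sq_pos_of_ne_zero (hPne x hx)) (sq_pos_of_ne_zero (hQne x hx))
  obtain ⟨hb, hb'⟩ := exp_le_and_exp_neg_le (mul_pos hE (hsq x hx)) (hBM x hx)
  obtain ⟨ha, ha'⟩ := exp_le_and_exp_neg_le hE (hAM x hx)
  simp only [← mul_assoc] at ha hb
  exact ⟨hb, hb', ha, ha'⟩
end

section
/- Let 0 < ε < 1/2, M > 0, and let f : (−1,1) → ℝ be continuous with |f(s)| ≤ M(1−s²)^{−1−2ε} for all s ∈ (−1,1). Define ψ(x) = ∫₀ˣ∫₀ˡ∫₀ᵗ 2f(s) ds dt dl. Then ψ extends continuously to [−1,1] (in particular the limits ψ(−1) and ψ(1) exist and are finite), there is a constant C = C(ε) with |ψ(−1)| ≤ CM and |ψ(1)| ≤ CM, and for all x ∈ (−1,1): |ψ(x) − ½ψ(−1)(1−x) − ½ψ(1)(1+x)| ≤ C(ε) M (1−x²)^{1−2ε}. -/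
open Set Filter

/-- On `(-1, 1)` the primitive from `0` of a continuous function is differentiable. -/
lemma hasDerivAt_integral_of_continuousOn_Ioo_s3 {g : ℝ → ℝ} (hg : ContinuousOn g (Ioo (-1:ℝ) 1))
    {x : ℝ} (hx : x ∈ Ioo (-1:ℝ) 1) :
    HasDerivAt (fun t => ∫ s in (0:ℝ)..t, g s) (g x) x := by
  have hsub : uIcc 0 x ⊆ Ioo (-1:ℝ) 1 :=
    ordConnected_Ioo.uIcc_subset (by norm_num) hx
  exact intervalIntegral.integral_hasDerivAt_right (hg.mono hsub).intervalIntegrable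
    (hg.stronglyMeasurableAtFilter isOpen_Ioo x hx) (hg.continuousAt (isOpen_Ioo.mem_nhds hx))

lemma abs_integral_le_of_nonneg {g : ℝ → ℝ} {A p : ℝ} (hp : p + 1 ≠ 0)
    (hb : ∀ s ∈ Ioo (-1:ℝ) 1, |g s| ≤ A * (1 - |s|) ^ p) {t : ℝ} (h0 : 0 ≤ t) (h1 : t < 1) :
    |∫ s in (0:ℝ)..t, g s| ≤ A * ((1 - (1 - t) ^ (p + 1)) / (p + 1)) := by
  have hc : ContinuousOn (fun s : ℝ => A * (1 - s) ^ p) (uIcc 0 t) := by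
    rw [uIcc_of_le h0]
    refine continuousOn_const.mul (ContinuousOn.rpow_const (by fun_prop) fun s hs => Or.inl ?_)
    have := hs.2
    linarith
  have key : ∫ s in (0:ℝ)..t, A * (1 - s) ^ p = A * ((1 - (1 - t) ^ (p + 1)) / (p + 1)) := by
    rw [intervalIntegral.integral_eq_sub_of_hasDerivAt
      (f := fun s : ℝ => -(A * (1 - s) ^ (p + 1) / (p + 1))) _ hc.intervalIntegrable]
    · simp only [sub_zero, Real.one_rpow]
      ring
    · intro s hs
      rw [uIcc_of_le h0] at hs
      have hs1 : 1 - s ≠ 0 := by linarith [hs.2]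
      have h := ((((hasDerivAt_id s).const_sub 1).rpow_const (p := p + 1)
        (Or.inl hs1)).const_mul A).div_const (p + 1) |>.neg
      refine h.congr_deriv ?_
      simp only [id, add_sub_cancel_right]
      field_simp
  rw [← key, ← Real.norm_eq_abs]
  refine intervalIntegral.norm_integral_le_of_norm_le h0 (Eventually.of_forall fun s hs => ?_)
    hc.intervalIntegrable
  have := hb s ⟨by linarith [hs.1], by linarith [hs.2]⟩
  rwa [abs_of_pos hs.1] at this

lemma abs_integral_le {g : ℝ → ℝ} {A p : ℝ} (hp : p + 1 ≠ 0)
    (hb : ∀ s ∈ Ioo (-1:ℝ) 1, |g s| ≤ A * (1 - |s|) ^ p) {t : ℝ} (ht : t ∈ Ioo (-1:ℝ) 1) :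
    |∫ s in (0:ℝ)..t, g s| ≤ A * ((1 - (1 - |t|) ^ (p + 1)) / (p + 1)) := by
  rcases le_total 0 t with h | h
  · rw [abs_of_nonneg h]
    exact abs_integral_le_of_nonneg hp hb h ht.2
  · have hneg : ∀ s ∈ Ioo (-1:ℝ) 1, |g (-s)| ≤ A * (1 - |s|) ^ p := fun s hs => by
      simpa using hb (-s) ⟨by linarith [hs.2], by linarith [hs.1]⟩
    have := abs_integral_le_of_nonneg hp hneg (t := -t) (by linarith) (by linarith [ht.1])
    rw [intervalIntegral.integral_comp_neg, neg_neg, neg_zero,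
      intervalIntegral.integral_symm, abs_neg] at this
    rwa [abs_of_nonpos h]

/-- A Lipschitz function deviates from its linear interpolation at `±1` by at most
`K * (1 - x ^ 2)`. -/
lemma abs_sub_linear_interpolation_le {g : ℝ → ℝ} {K : ℝ}
    (hg : ∀ x y, |g x - g y| ≤ K * |x - y|) {x : ℝ} (hx : x ∈ Icc (-1:ℝ) 1) :
    |g x - g (-1) * (1 - x) / 2 - g 1 * (1 + x) / 2| ≤ K * (1 - x ^ 2) := by
  have h1 := hg x (-1)
  have h2 := hg x 1
  rw [abs_of_nonneg (by linarith [hx.1] : 0 ≤ x - -1), abs_le] at h1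
  rw [abs_of_nonpos (by linarith [hx.2] : x - 1 ≤ 0), abs_le] at h2
  have hl : 0 ≤ 1 - x := by linarith [hx.2]
  have hr : 0 ≤ 1 + x := by linarith [hx.1]
  rw [abs_le]
  constructor
  · nlinarith [mul_le_mul_of_nonneg_right h1.1 hl, mul_le_mul_of_nonneg_right h2.1 hr]
  · nlinarith [mul_le_mul_of_nonneg_right h1.2 hl, mul_le_mul_of_nonneg_right h2.2 hr]

/-- The double primitive of a function bounded by `M * (1 - s ^ 2) ^ (-1 - 2 * ε)` is bounded. -/
lemma abs_double_integral_le {ε : ℝ} (hε : 0 < ε) (hε2 : ε < 1/2) {f : ℝ → ℝ} {M : ℝ}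
    (hM : 0 < M)
    (hb : ∀ s ∈ Ioo (-1:ℝ) 1, |f s| ≤ M * (1 - s ^ 2) ^ (-1 - 2 * ε))
    {l : ℝ} (hl : l ∈ Ioo (-1:ℝ) 1) :
    |∫ t in (0:ℝ)..l, ∫ s in (0:ℝ)..t, 2 * f s| ≤ 1 / (ε * (1 - 2 * ε)) * M := by
  have hd : 0 < 1 - 2 * ε := by linarith
  have pos : ∀ s ∈ Ioo (-1:ℝ) 1, 0 < 1 - |s| := fun s hs => by
    linarith [abs_lt.mpr hs]
  have b0 : ∀ s ∈ Ioo (-1:ℝ) 1, |2 * f s| ≤ (2 * M) * (1 - |s|) ^ (-1 - 2 * ε) := by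
    intro s hs
    have hle : (1 - s ^ 2) ^ (-1 - 2 * ε) ≤ (1 - |s|) ^ (-1 - 2 * ε) := by
      refine Real.rpow_le_rpow_of_nonpos (pos s hs) ?_ (by linarith)
      nlinarith [sq_abs s, abs_nonneg s, pos s hs]
    rw [abs_mul, abs_two, mul_assoc]
    have := (hb s hs).trans (mul_le_mul_of_nonneg_left hle hM.le)
    linarith
  have b1 : ∀ t ∈ Ioo (-1:ℝ) 1,
      |∫ s in (0:ℝ)..t, 2 * f s| ≤ (M / ε) * (1 - |t|) ^ (-2 * ε) := by
    intro t ht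
    refine (abs_integral_le (by linarith : -1 - 2 * ε + 1 ≠ 0) b0 ht).trans ?_
    rw [show -1 - 2 * ε + 1 = -2 * ε by ring]
    have : 2 * M * ((1 - (1 - |t|) ^ (-2 * ε)) / (-2 * ε))
        = M / ε * (1 - |t|) ^ (-2 * ε) - M / ε := by
      field_simp
      ring
    rw [this]
    have : 0 < M / ε := by positivity
    linarith
  refine (abs_integral_le (by linarith : -2 * ε + 1 ≠ 0) b1 hl).trans ?_
  rw [show -2 * ε + 1 = 1 - 2 * ε by ring]
  have h : (1 - (1 - |l|) ^ (1 - 2 * ε)) / (1 - 2 * ε) ≤ 1 / (1 - 2 * ε) := by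
    gcongr
    linarith [Real.rpow_nonneg (pos l hl).le (1 - 2 * ε)]
  calc _ ≤ M / ε * (1 / (1 - 2 * ε)) := by gcongr
    _ = _ := by field_simp

/-- the triple integral `ψ(x) = ∫₀ˣ∫₀ˡ∫₀ᵗ 2f(s) ds dt dl` of a function
bounded by `M(1−s²)^{−1−2ε}` extends continuously to `[−1,1]`, its boundary values are
bounded by `C(ε)·M`, and `ψ` minus its linear interpolation at `±1` is bounded by
`C(ε)·M·(1−x²)^{1−2ε}`. -/
theorem stmt3 (ε : ℝ) (hε : 0 < ε) (hε2 : ε < 1/2) :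
    ∃ C > 0, ∀ (f : ℝ → ℝ) (M : ℝ), 0 < M →
      ContinuousOn f (Ioo (-1:ℝ) 1) →
      (∀ s ∈ Ioo (-1:ℝ) 1, |f s| ≤ M * (1-s^2) ^ (-1-2*ε)) →
      ∃ Ψ : ℝ → ℝ, ContinuousOn Ψ (Icc (-1:ℝ) 1) ∧
        (∀ x ∈ Ioo (-1:ℝ) 1,
          Ψ x = ∫ l in (0:ℝ)..x, ∫ t in (0:ℝ)..l, ∫ s in (0:ℝ)..t, 2 * f s) ∧
        |Ψ (-1)| ≤ C * M ∧ |Ψ 1| ≤ C * M ∧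
        ∀ x ∈ Ioo (-1:ℝ) 1,
          |(∫ l in (0:ℝ)..x, ∫ t in (0:ℝ)..l, ∫ s in (0:ℝ)..t, 2 * f s)
              - Ψ (-1) * (1-x) / 2 - Ψ 1 * (1+x) / 2|
            ≤ C * M * (1-x^2) ^ (1-2*ε) := by
  have hd : 0 < 1 - 2 * ε := by linarith
  have hC : 0 < 1 / (ε * (1 - 2 * ε)) := by positivity
  refine ⟨1 / (ε * (1 - 2 * ε)), hC, fun f M hM hf hb => ?_⟩
  set C := 1 / (ε * (1 - 2 * ε))
  have c1 : ContinuousOn (fun t => ∫ s in (0:ℝ)..t, 2 * f s) (Ioo (-1:ℝ) 1) := fun x hx =>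
    (hasDerivAt_integral_of_continuousOn_Ioo_s3 (continuousOn_const.mul hf)
      hx).continuousAt.continuousWithinAt
  have c2 : ContinuousOn (fun l => ∫ t in (0:ℝ)..l, ∫ s in (0:ℝ)..t, 2 * f s)
      (Ioo (-1:ℝ) 1) := fun x hx =>
    (hasDerivAt_integral_of_continuousOn_Ioo_s3 c1 hx).continuousAt.continuousWithinAt
  have hlip := (convex_Ioo (-1:ℝ) 1).lipschitzOnWith_of_nnnorm_hasDerivWithin_le
    (C := (C * M).toNNReal)
    (fun x hx => (hasDerivAt_integral_of_continuousOn_Ioo_s3 c2 hx).hasDerivWithinAt)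
    (fun x hx => by
      rw [← NNReal.coe_le_coe, coe_nnnorm, Real.norm_eq_abs,
        Real.coe_toNNReal _ (mul_pos hC hM).le]
      exact abs_double_integral_le hε hε2 hM hb hx)
  obtain ⟨Ψ, hΨ, heq⟩ := hlip.extend_real
  have hdist : ∀ x y, |Ψ x - Ψ y| ≤ C * M * |x - y| := fun x y => by
    have := hΨ.dist_le_mul x y
    rwa [Real.dist_eq, Real.dist_eq, Real.coe_toNNReal _ (mul_pos hC hM).le] at this
  have h0 : Ψ 0 = 0 := by
    rw [← heq (by norm_num : (0:ℝ) ∈ Ioo (-1:ℝ) 1)]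
    exact intervalIntegral.integral_same
  refine ⟨Ψ, hΨ.continuous.continuousOn, fun x hx => (heq hx).symm, ?_, ?_, fun x hx => ?_⟩
  · simpa [h0] using hdist (-1) 0
  · simpa [h0] using hdist 1 0
  · have hx2 : 0 < 1 - x ^ 2 := by nlinarith [hx.1, hx.2]
    have hpow : 1 - x ^ 2 ≤ (1 - x ^ 2) ^ (1 - 2 * ε) := by
      simpa using Real.rpow_le_rpow_of_exponent_ge hx2 (by linarith [sq_nonneg x])
        (by linarith : 1 - 2 * ε ≤ 1)
    have h := abs_sub_linear_interpolation_le hdist (Ioo_subset_Icc_self hx)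
    rw [← heq hx] at h
    exact h.trans (mul_le_mul_of_nonneg_left hpow (mul_pos hC hM).le)
end

section
/- Let ε ∈ (0,1/2). Suppose Ũθ and Ṽθ are C¹ on (−1,1), C³ on (−1/2,1/2), with finite M₁-norms, and Ũφ, Ṽφ ∈ C²(−1,1) have finite M₂-norms. Then ψ[Ũφ,Ṽφ] extends continuously to [−1,1]; define Qθ(x) = ½Ũθ(x)Ṽθ(x) + ψ[Ũφ,Ṽφ](x) − ½(1−x)ψ[Ũφ,Ṽφ](−1) − ½(1+x)ψ[Ũφ,Ṽφ](1) + ¼(ŨθṼθ)''(0)(1−x²) and Qφ(x) = Ũθ(x)Ṽφ'(x). Then Qθ(x) → 0 as x → ±1, Qθ''(0) = 0, and there exists a constant C depending only on ε such that the N₁-norm of Qθ plus the N₂-norm of Qφ is at most C·(M₁-norm of Ũθ + M₂-norm of Ũφ)·(M₁-norm of Ṽθ + M₂-norm of Ṽφ). -/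
open Set Filter

theorem hasDerivAt_primitive_of_continuousOn_Ioo {g : ℝ → ℝ} (hg : ContinuousOn g (Ioo (-1) 1))
    {x : ℝ} (hx : x ∈ Ioo (-1 : ℝ) 1) :
    HasDerivAt (fun t => ∫ s in (0 : ℝ)..t, g s) (g x) x := by
  have hsub : uIcc 0 x ⊆ Ioo (-1 : ℝ) 1 :=
    ordConnected_Ioo.uIcc_subset ⟨by norm_num, by norm_num⟩ hx
  exact intervalIntegral.integral_hasDerivAt_right (hg.mono hsub).intervalIntegrable
    (hg.stronglyMeasurableAtFilter isOpen_Ioo x hx) (hg.continuousAt (isOpen_Ioo.mem_nhds hx))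

theorem continuousOn_primitive_Ioo {g : ℝ → ℝ} (hg : ContinuousOn g (Ioo (-1) 1)) :
    ContinuousOn (fun t => ∫ s in (0 : ℝ)..t, g s) (Ioo (-1) 1) :=
  fun _ hx => (hasDerivAt_primitive_of_continuousOn_Ioo hg hx).continuousAt.continuousWithinAt

theorem hasDerivAt_one_sub_rpow {p K x : ℝ} (hp : p ≠ 0) (hx : x < 1) :
    HasDerivAt (fun t => K / p * (1 - t) ^ (-p)) (K * (1 - x) ^ (-p - 1)) x := by
  have h := ((hasDerivAt_id' x).const_sub 1).rpow_const (p := -p) (Or.inl (sub_pos.2 hx).ne')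
  refine (h.const_mul (K / p)).congr_deriv ?_
  field_simp

theorem abs_primitive_le_of_nonneg {g : ℝ → ℝ} (hg : ContinuousOn g (Ioo (-1) 1)) {p K : ℝ}
    (hp : 0 < p) (hK : 0 ≤ K)
    (hb : ∀ x ∈ Ioo (-1 : ℝ) 1, |g x| ≤ K * (1 - |x|) ^ (-p - 1)) {x : ℝ} (hx0 : 0 ≤ x)
    (hx1 : x < 1) : |∫ s in (0 : ℝ)..x, g s| ≤ K / p * (1 - x) ^ (-p) := by
  have hmem : ∀ t ∈ Icc 0 x, t ∈ Ioo (-1 : ℝ) 1 := fun t ht =>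
    ⟨by linarith [ht.1], by linarith [ht.2]⟩
  refine image_norm_le_of_norm_deriv_right_le_deriv_boundary'
    (f := fun t => ∫ s in (0 : ℝ)..t, g s) (f' := g) (a := 0) (b := x)
    (B := fun t => K / p * (1 - t) ^ (-p)) (B' := fun t => K * (1 - t) ^ (-p - 1))
    ?_ ?_ ?_ ?_ ?_ ?_ ⟨hx0, le_rfl⟩
  · exact (continuousOn_primitive_Ioo hg).mono hmem
  · intro t ht
    exact (hasDerivAt_primitive_of_continuousOn_Ioo hg
      (hmem t (Ico_subset_Icc_self ht))).hasDerivWithinAt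
  · simp; positivity
  · intro t ht
    exact (hasDerivAt_one_sub_rpow hp.ne' (hmem t ht).2).continuousAt.continuousWithinAt
  · intro t ht
    exact (hasDerivAt_one_sub_rpow hp.ne' (hmem t (Ico_subset_Icc_self ht)).2).hasDerivWithinAt
  · intro t ht
    have := hb t (hmem t (Ico_subset_Icc_self ht))
    rwa [abs_of_nonneg ht.1] at this

theorem continuousOn_comp_neg_Ioo {g : ℝ → ℝ} (hg : ContinuousOn g (Ioo (-1) 1)) :
    ContinuousOn (fun x => g (-x)) (Ioo (-1) 1) :=
  hg.comp continuousOn_neg fun x hx => ⟨by linarith [hx.2], by linarith [hx.1]⟩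

theorem integral_zero_neg (g : ℝ → ℝ) (x : ℝ) :
    ∫ s in (0 : ℝ)..(-x), g s = -∫ s in (0 : ℝ)..x, g (-s) := by
  rw [intervalIntegral.integral_comp_neg, neg_zero, ← intervalIntegral.integral_symm]

theorem abs_primitive_le {g : ℝ → ℝ} (hg : ContinuousOn g (Ioo (-1) 1)) {p K : ℝ}
    (hp : 0 < p) (hK : 0 ≤ K)
    (hb : ∀ x ∈ Ioo (-1 : ℝ) 1, |g x| ≤ K * (1 - |x|) ^ (-p - 1)) :
    ∀ x ∈ Ioo (-1 : ℝ) 1, |∫ s in (0 : ℝ)..x, g s| ≤ K / p * (1 - |x|) ^ (-p) := by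
  intro x hx
  rcases le_total 0 x with h | h
  · rw [abs_of_nonneg h]
    exact abs_primitive_le_of_nonneg hg hp hK hb h hx.2
  · rw [abs_of_nonpos h]
    have hneg := integral_zero_neg g (-x)
    rw [neg_neg] at hneg
    rw [hneg, abs_neg]
    refine abs_primitive_le_of_nonneg (continuousOn_comp_neg_Ioo hg) hp hK (fun t ht => ?_)
      (by linarith) (by linarith [hx.1])
    simpa using hb (-t) ⟨by linarith [ht.2], by linarith [ht.1]⟩

theorem intervalIntegrable_one_sub_rpow {q a b : ℝ} (hq : q < 1) :
    IntervalIntegrable (fun t : ℝ => (1 - t) ^ (-q)) MeasureTheory.volume a b := by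
  simpa using (intervalIntegral.intervalIntegrable_rpow' (r := -q) (by linarith)
    (a := 1 - a) (b := 1 - b)).comp_sub_left 1

theorem intervalIntegrable_zero_one {H : ℝ → ℝ} (hH : ContinuousOn H (Ioo (-1) 1)) {q K : ℝ}
    (hq : q < 1) (hb : ∀ x ∈ Ioo (-1 : ℝ) 1, |H x| ≤ K * (1 - |x|) ^ (-q)) :
    IntervalIntegrable H MeasureTheory.volume 0 1 := by
  have hsub : Ioo (0 : ℝ) 1 ⊆ Ioo (-1) 1 := Ioo_subset_Ioo_left (by norm_num)
  have hd : MeasureTheory.IntegrableOn (fun t : ℝ => K * (1 - t) ^ (-q)) (Ioo 0 1) :=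
    (intervalIntegrable_iff_integrableOn_Ioo_of_le zero_le_one).1
      ((intervalIntegrable_one_sub_rpow hq).const_mul K)
  refine (intervalIntegrable_iff_integrableOn_Ioo_of_le zero_le_one).2 (hd.mono'
    ((hH.mono hsub).aestronglyMeasurable measurableSet_Ioo) ?_)
  filter_upwards [MeasureTheory.ae_restrict_mem measurableSet_Ioo] with t ht
  have := hb t (hsub ht)
  rwa [abs_of_pos ht.1] at this

theorem intervalIntegrable_neg_one_one {H : ℝ → ℝ} (hH : ContinuousOn H (Ioo (-1) 1)) {q K : ℝ}
    (hq : q < 1) (hb : ∀ x ∈ Ioo (-1 : ℝ) 1, |H x| ≤ K * (1 - |x|) ^ (-q)) :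
    IntervalIntegrable H MeasureTheory.volume (-1) 1 := by
  refine IntervalIntegrable.trans (b := 0) ?_ (intervalIntegrable_zero_one hH hq hb)
  have := intervalIntegrable_zero_one (continuousOn_comp_neg_Ioo hH) hq (K := K) fun t ht => by
    simpa using hb (-t) ⟨by linarith [ht.2], by linarith [ht.1]⟩
  simpa using ((IntervalIntegrable.iff_comp_neg).1 this).symm

theorem continuousOn_primitive_Icc {H : ℝ → ℝ}
    (hH : IntervalIntegrable H MeasureTheory.volume (-1) 1) :
    ContinuousOn (fun x => ∫ s in (0 : ℝ)..x, H s) (Icc (-1) 1) := by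
  have := intervalIntegral.continuousOn_primitive_interval'
    (a := 0) hH (by rw [uIcc_of_le] <;> norm_num)
  rwa [uIcc_of_le (by norm_num)] at this

theorem abs_integral_one_sub_le {H : ℝ → ℝ} (hH : ContinuousOn H (Ioo (-1) 1)) {q K : ℝ}
    (hq : q < 1) (hb : ∀ x ∈ Ioo (-1 : ℝ) 1, |H x| ≤ K * (1 - |x|) ^ (-q)) {x : ℝ}
    (hx0 : 0 ≤ x) (hx1 : x < 1) :
    |(∫ s in (0 : ℝ)..1, H s) - ∫ s in (0 : ℝ)..x, H s| ≤ K / (1 - q) * (1 - x) ^ (1 - q) := by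
  have hI := intervalIntegrable_zero_one hH hq hb
  rw [intervalIntegral.integral_interval_sub_left hI
    (hI.mono_set (by
      rw [uIcc_of_le hx0, uIcc_of_le zero_le_one]; exact Icc_subset_Icc_right hx1.le))]
  have hval : ∫ t in x..1, K * (1 - t) ^ (-q) = K / (1 - q) * (1 - x) ^ (1 - q) := by
    rw [intervalIntegral.integral_const_mul,
      intervalIntegral.integral_comp_sub_left (fun t : ℝ => t ^ (-q)) 1,
      integral_rpow (Or.inl (by linarith)), sub_self,
      Real.zero_rpow (by linarith : 0 < -q + 1).ne']
    rw [show -q + 1 = 1 - q by ring, sub_zero]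
    ring
  rw [← hval, ← Real.norm_eq_abs]
  refine intervalIntegral.norm_integral_le_of_norm_le hx1.le ?_
    ((intervalIntegrable_one_sub_rpow hq).const_mul K)
  have h1 : ∀ᵐ t : ℝ, t ≠ 1 := by simp [MeasureTheory.ae_iff]
  filter_upwards [h1] with t ht1 ht
  have := hb t ⟨by linarith [ht.1], lt_of_le_of_ne ht.2 ht1⟩
  rwa [abs_of_pos (by linarith [ht.1] : (0 : ℝ) < t)] at this

theorem abs_integral_neg_one_sub_le {H : ℝ → ℝ} (hH : ContinuousOn H (Ioo (-1) 1)) {q K : ℝ}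
    (hq : q < 1) (hb : ∀ x ∈ Ioo (-1 : ℝ) 1, |H x| ≤ K * (1 - |x|) ^ (-q)) {x : ℝ}
    (hx0 : x ≤ 0) (hx1 : -1 < x) :
    |(∫ s in (0 : ℝ)..(-1), H s) - ∫ s in (0 : ℝ)..x, H s| ≤
      K / (1 - q) * (1 + x) ^ (1 - q) := by
  have h := abs_integral_one_sub_le (continuousOn_comp_neg_Ioo hH) hq (K := K) (fun t ht => by
    simpa using hb (-t) ⟨by linarith [ht.2], by linarith [ht.1]⟩)
    (x := -x) (by linarith) (by linarith)
  have e := integral_zero_neg H (-x)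
  rw [neg_neg] at e
  rw [integral_zero_neg H 1, e, neg_sub_neg, abs_sub_comm]
  simpa using h

/-- The difference between a primitive and its linear interpolation between the endpoints `±1`
decays like a power of the distance to the boundary. -/
theorem abs_primitive_sub_linear_le {H : ℝ → ℝ} (hH : ContinuousOn H (Ioo (-1) 1)) {q K : ℝ}
    (hq0 : 0 < q) (hq : q < 1) (hK : 0 ≤ K)
    (hb : ∀ x ∈ Ioo (-1 : ℝ) 1, |H x| ≤ K * (1 - |x|) ^ (-q)) {x : ℝ}
    (hx : x ∈ Ioo (-1 : ℝ) 1) :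
    |(∫ s in (0 : ℝ)..x, H s) - (∫ s in (0 : ℝ)..(-1), H s) * (1 - x) / 2
      - (∫ s in (0 : ℝ)..1, H s) * (1 + x) / 2| ≤ 2 * (K / (1 - q)) * (1 - |x|) ^ (1 - q) := by
  have hp : |∫ s in (0 : ℝ)..1, H s| ≤ K / (1 - q) := by
    simpa using abs_integral_one_sub_le hH hq hb le_rfl one_pos
  have hm : |∫ s in (0 : ℝ)..(-1), H s| ≤ K / (1 - q) := by
    simpa using abs_integral_neg_one_sub_le hH hq hb le_rfl (by norm_num : (-1 : ℝ) < 0)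
  have hL : 0 ≤ K / (1 - q) := div_nonneg hK (by linarith)
  have hx' : |x| < 1 := abs_lt.2 hx
  have hlin : 1 - |x| ≤ (1 - |x|) ^ (1 - q) :=
    Real.self_le_rpow_of_le_one (by linarith) (by linarith [abs_nonneg x]) (by linarith)
  have hlin' := mul_le_mul_of_nonneg_left hlin hL
  set P := ∫ s in (0 : ℝ)..1, H s
  set N := ∫ s in (0 : ℝ)..(-1), H s
  have hPN : |(P - N) / 2 * (1 - |x|)| ≤ K / (1 - q) * (1 - |x|) := by
    rw [abs_mul, abs_of_pos (by linarith : 0 < 1 - |x|)]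
    refine mul_le_mul_of_nonneg_right ?_ (by linarith)
    rw [abs_le] at *
    constructor <;> linarith
  rw [abs_le] at hPN ⊢
  rcases le_total 0 x with h | h
  · rw [abs_of_nonneg h] at *
    have := abs_le.1 (abs_integral_one_sub_le hH hq hb h hx.2)
    constructor <;> nlinarith
  · rw [abs_of_nonpos h] at *
    have := abs_le.1 (abs_integral_neg_one_sub_le hH hq hb h hx.1)
    rw [sub_neg_eq_add] at *
    constructor <;> nlinarith

theorem le_mul_rpow_neg_of_rpow_mul_le {w a y M : ℝ} (hw : 0 < w) (h : w ^ a * y ≤ M) :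
    y ≤ M * w ^ (-a) := by
  rw [Real.rpow_neg hw.le, ← div_eq_mul_inv, le_div_iff₀ (Real.rpow_pos_of_pos hw a)]
  linarith

theorem rpow_mul_le_of_le_mul_rpow_neg {w a y M : ℝ} (hw : 0 < w) (h : y ≤ M * w ^ (-a)) :
    w ^ a * y ≤ M := by
  rw [Real.rpow_neg hw.le, ← div_eq_mul_inv, le_div_iff₀ (Real.rpow_pos_of_pos hw a)] at h
  linarith

theorem one_sub_sq_pos_of_mem_Ioo {x : ℝ} (hx : x ∈ Ioo (-1 : ℝ) 1) : 0 < 1 - x ^ 2 := by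
  nlinarith [hx.1, hx.2]

theorem one_sub_abs_le_one_sub_sq {x : ℝ} (hx : x ∈ Ioo (-1 : ℝ) 1) : 1 - |x| ≤ 1 - x ^ 2 := by
  nlinarith [abs_lt.2 hx, abs_nonneg x, sq_abs x]

theorem tendsto_zero_of_abs_le_one_sub_sq_rpow {Q : ℝ → ℝ} {M b x₀ : ℝ} (hb : 0 < b)
    (hx₀ : x₀ ^ 2 = 1) (hQ : ∀ x ∈ Ioo (-1 : ℝ) 1, |Q x| ≤ M * (1 - x ^ 2) ^ b) :
    Tendsto Q (nhdsWithin x₀ (Ioo (-1 : ℝ) 1)) (nhds 0) := by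
  have hc : Tendsto (fun x : ℝ => M * (1 - x ^ 2) ^ b) (nhdsWithin x₀ (Ioo (-1 : ℝ) 1))
      (nhds 0) := by
    have : ContinuousAt (fun x : ℝ => M * (1 - x ^ 2) ^ b) x₀ :=
      continuousAt_const.mul (ContinuousAt.rpow_const (by fun_prop) (Or.inr hb.le))
    have h0 := this.tendsto
    simp only [hx₀, sub_self, Real.zero_rpow hb.ne', mul_zero] at h0
    exact h0.mono_left nhdsWithin_le_nhds
  refine squeeze_zero_norm' ?_ hc
  filter_upwards [self_mem_nhdsWithin] with x hx using hQ x hx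

theorem deriv_eq_and_deriv_deriv_eq {f f' f'' : ℝ → ℝ} {s : Set ℝ} (hs : IsOpen s)
    (h1 : ∀ x ∈ s, HasDerivAt f (f' x) x) (h2 : ∀ x ∈ s, HasDerivAt f' (f'' x) x) {x : ℝ}
    (hx : x ∈ s) : deriv f x = f' x ∧ deriv (deriv f) x = f'' x := by
  refine ⟨(h1 x hx).deriv, ?_⟩
  have : deriv f =ᶠ[nhds x] f' := by
    filter_upwards [hs.mem_nhds hx] with y hy using (h1 y hy).deriv
  rw [this.deriv_eq, (h2 x hx).deriv]

theorem abs_mul_le_mul {a b A B : ℝ} (ha : |a| ≤ A) (hb : |b| ≤ B) : |a * b| ≤ A * B := by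
  rw [abs_mul]
  exact mul_le_mul ha hb (abs_nonneg b) ((abs_nonneg a).trans ha)

theorem abs_le_of_weighted_bounds {ε : ℝ} (hε : 0 < ε) (hε2 : ε < 1 / 2) {U U' : ℝ → ℝ} {M : ℝ}
    (hU : ∀ x ∈ Ioo (-1 : ℝ) 1, (1 - x ^ 2) ^ (-1 + 2 * ε) * |U x| ≤ M ∧
      (1 - x ^ 2) ^ (2 * ε) * |U' x| ≤ M) :
    0 ≤ M ∧ |U' 0| ≤ M ∧
      (∀ x ∈ Ioo (-1 : ℝ) 1, |U x| ≤ M * (1 - x ^ 2) ^ (1 - 2 * ε) ∧ |U x| ≤ M) ∧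
      ∀ x ∈ Ioo (-(1 : ℝ) / 2) (1 / 2), |U' x| ≤ 2 * M := by
  have h0 : |U 0| ≤ M ∧ |U' 0| ≤ M := by simpa using hU 0 (by norm_num)
  have hM : 0 ≤ M := (abs_nonneg _).trans h0.1
  refine ⟨hM, h0.2, fun x hx => ?_, fun x hx => ?_⟩
  · have hw := one_sub_sq_pos_of_mem_Ioo hx
    have h := le_mul_rpow_neg_of_rpow_mul_le hw (hU x hx).1
    rw [show -(-1 + 2 * ε) = 1 - 2 * ε by ring] at h
    refine ⟨h, h.trans (mul_le_of_le_one_right hM ?_)⟩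
    exact Real.rpow_le_one hw.le (by nlinarith) (by linarith)
  · have hx' : x ∈ Ioo (-1 : ℝ) 1 := ⟨by linarith [hx.1], by linarith [hx.2]⟩
    have hw : 1 / 2 ≤ 1 - x ^ 2 := by nlinarith [hx.1, hx.2]
    have hr : 1 / 2 ≤ (1 - x ^ 2) ^ (2 * ε) := hw.trans
      (Real.self_le_rpow_of_le_one (by linarith) (by nlinarith) (by linarith))
    nlinarith [(hU x hx').2, abs_nonneg (U' x)]

theorem abs_source_le {ε u v' MU MV x : ℝ} (hε : 0 < ε) (hMU : 0 ≤ MU) (hMV : 0 ≤ MV)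
    (hx : x ∈ Ioo (-1 : ℝ) 1) (hu : (1 - x ^ 2) ^ ε * |u| ≤ MU)
    (hv : (1 - x ^ 2) ^ (1 + ε) * |v'| ≤ MV) :
    |2 * u * v' / (1 - x ^ 2)| ≤ 2 * MU * MV * (1 - |x|) ^ (-(1 + 2 * ε) - 1) := by
  have hw := one_sub_sq_pos_of_mem_Ioo hx
  have h := abs_mul_le_mul (le_mul_rpow_neg_of_rpow_mul_le hw hu)
    (le_mul_rpow_neg_of_rpow_mul_le hw hv)
  have hpow : (1 - x ^ 2) ^ (-(1 + 2 * ε) - 1) =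
      (1 - x ^ 2) ^ (-ε) * (1 - x ^ 2) ^ (-(1 + ε)) / (1 - x ^ 2) := by
    rw [← Real.rpow_add hw, ← Real.rpow_sub_one hw.ne']
    congr 1
    ring
  calc |2 * u * v' / (1 - x ^ 2)| = 2 * |u * v'| / (1 - x ^ 2) := by
        rw [abs_div, abs_of_pos hw, mul_assoc, abs_mul, abs_two]
    _ ≤ 2 * (MU * (1 - x ^ 2) ^ (-ε) * (MV * (1 - x ^ 2) ^ (-(1 + ε)))) / (1 - x ^ 2) := by
        gcongr
    _ = 2 * MU * MV * (1 - x ^ 2) ^ (-(1 + 2 * ε) - 1) := by rw [hpow]; ring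
    _ ≤ _ := by
        refine mul_le_mul_of_nonneg_left ?_ (by positivity)
        exact Real.rpow_le_rpow_of_nonpos (by linarith [abs_lt.2 hx])
          (one_sub_abs_le_one_sub_sq hx) (by linarith)

theorem one_sub_abs_rpow_neg_le {p : ℝ} (hp : 0 ≤ p) {n : ℕ} (hpn : p ≤ n) {x : ℝ}
    (hx : x ∈ Ioo (-(1 : ℝ) / 2) (1 / 2)) : (1 - |x|) ^ (-p) ≤ 2 ^ n := by
  have hx' : |x| < 1 / 2 := abs_lt.2 ⟨by linarith [hx.1], hx.2⟩
  calc (1 - |x|) ^ (-p) ≤ (1 / 2 : ℝ) ^ (-p) :=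
        Real.rpow_le_rpow_of_nonpos (by norm_num) (by linarith) (by linarith)
    _ = 2 ^ p := by
        rw [one_div, Real.inv_rpow (by norm_num), ← Real.rpow_neg (by norm_num), neg_neg]
    _ ≤ 2 ^ (n : ℝ) := Real.rpow_le_rpow_of_exponent_le (by norm_num) hpn
    _ = 2 ^ n := Real.rpow_natCast 2 n

/-- the bilinear operator `Q = (Qθ, Qφ)` built from
`ψ[Ũφ,Ṽφ](x) = ∫₀ˣ∫₀ˡ∫₀ᵗ 2ŨφṼφ'/(1−s²)` maps `X × X` boundedly into `Y`,
with `Qθ → 0` at `±1` and `Qθ''(0) = 0` (plain power weights). -/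
theorem stmt5 (ε : ℝ) (hε : 0 < ε) (hε2 : ε < 1/2) :
    ∃ C > 0,
      ∀ (Ut Ut' Ut'' Ut''' Vt Vt' Vt'' Vt''' Uφ Uφ' Uφ'' Vφ Vφ' Vφ'' : ℝ → ℝ)
        (MU MV : ℝ),
      (∀ x ∈ Ioo (-1:ℝ) 1, HasDerivAt Ut (Ut' x) x) →
      (∀ x ∈ Ioo (-(1:ℝ)/2) (1/2), HasDerivAt Ut' (Ut'' x) x) →
      (∀ x ∈ Ioo (-(1:ℝ)/2) (1/2), HasDerivAt Ut'' (Ut''' x) x) →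
      (∀ x ∈ Ioo (-1:ℝ) 1, HasDerivAt Vt (Vt' x) x) →
      (∀ x ∈ Ioo (-(1:ℝ)/2) (1/2), HasDerivAt Vt' (Vt'' x) x) →
      (∀ x ∈ Ioo (-(1:ℝ)/2) (1/2), HasDerivAt Vt'' (Vt''' x) x) →
      (∀ x ∈ Ioo (-1:ℝ) 1, HasDerivAt Uφ (Uφ' x) x) →
      (∀ x ∈ Ioo (-1:ℝ) 1, HasDerivAt Uφ' (Uφ'' x) x) →
      (∀ x ∈ Ioo (-1:ℝ) 1, HasDerivAt Vφ (Vφ' x) x) →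
      (∀ x ∈ Ioo (-1:ℝ) 1, HasDerivAt Vφ' (Vφ'' x) x) →
      -- finite M₁-norms bounded by MU, MV
      (∀ x ∈ Ioo (-1:ℝ) 1,
        (1-x^2) ^ (-1+2*ε) * |Ut x| ≤ MU ∧ (1-x^2) ^ (2*ε) * |Ut' x| ≤ MU) →
      (∀ x ∈ Ioo (-(1:ℝ)/2) (1/2), |Ut'' x| ≤ MU ∧ |Ut''' x| ≤ MU) →
      (∀ x ∈ Ioo (-1:ℝ) 1,
        (1-x^2) ^ (-1+2*ε) * |Vt x| ≤ MV ∧ (1-x^2) ^ (2*ε) * |Vt' x| ≤ MV) →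
      (∀ x ∈ Ioo (-(1:ℝ)/2) (1/2), |Vt'' x| ≤ MV ∧ |Vt''' x| ≤ MV) →
      -- finite M₂-norms bounded by MU, MV
      (∀ x ∈ Ioo (-1:ℝ) 1,
        (1-x^2) ^ ε * |Uφ x| ≤ MU ∧ (1-x^2) ^ (1+ε) * |Uφ' x| ≤ MU ∧
          (1-x^2) ^ (2+ε) * |Uφ'' x| ≤ MU) →
      (∀ x ∈ Ioo (-1:ℝ) 1,
        (1-x^2) ^ ε * |Vφ x| ≤ MV ∧ (1-x^2) ^ (1+ε) * |Vφ' x| ≤ MV ∧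
          (1-x^2) ^ (2+ε) * |Vφ'' x| ≤ MV) →
      (let ψ : ℝ → ℝ := fun x =>
        ∫ l in (0:ℝ)..x, ∫ t in (0:ℝ)..l, ∫ s in (0:ℝ)..t, 2 * Uφ s * Vφ' s / (1-s^2)
       -- ψ extends continuously to [−1,1]
       ∃ Ψ : ℝ → ℝ, ContinuousOn Ψ (Icc (-1:ℝ) 1) ∧
        (∀ x ∈ Ioo (-1:ℝ) 1, Ψ x = ψ x) ∧
        (let Qθ : ℝ → ℝ := fun x =>
          Ut x * Vt x / 2 + ψ x - Ψ (-1) * (1-x) / 2 - Ψ 1 * (1+x) / 2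
            + deriv (deriv (fun y => Ut y * Vt y)) 0 * (1-x^2) / 4
         let Qφ : ℝ → ℝ := fun x => Ut x * Vφ' x
         Tendsto Qθ (nhdsWithin (-1:ℝ) (Ioo (-1:ℝ) 1)) (nhds 0) ∧
         Tendsto Qθ (nhdsWithin (1:ℝ) (Ioo (-1:ℝ) 1)) (nhds 0) ∧
         deriv (deriv Qθ) 0 = 0 ∧
         (∀ x ∈ Ioo (-1:ℝ) 1, (1-x^2) ^ (-1+2*ε) * |Qθ x| ≤ C * MU * MV) ∧
         (∀ x ∈ Ioo (-(1:ℝ)/2) (1/2),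
           |deriv Qθ x| ≤ C * MU * MV ∧ |deriv (deriv Qθ) x| ≤ C * MU * MV) ∧
         (∀ x ∈ Ioo (-1:ℝ) 1, (1-x^2) ^ (1+ε) * |Qφ x| ≤ C * MU * MV))) := by
  set A : ℝ := 2 / (1 + 2 * ε) / (2 * ε) / (1 - 2 * ε) with hA
  have hq : 0 < 1 - 2 * ε := by linarith
  have hA0 : 0 < A := by positivity
  refine ⟨4 * A + 20, by positivity, ?_⟩
  intro Ut Ut' Ut'' Ut''' Vt Vt' Vt'' Vt''' Uφ Uφ' Uφ'' Vφ Vφ' Vφ'' MU MV hUt hUt' _ hVt hVt' _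
    hUφ _ _ hVφ' hbU hbU2 hbV hbV2 hbUφ hbVφ
  obtain ⟨hMU, hU'0, hU, hU'⟩ := abs_le_of_weighted_bounds hε hε2 hbU
  obtain ⟨hMV, hV'0, hV, hV'⟩ := abs_le_of_weighted_bounds hε hε2 hbV
  have hMM : 0 ≤ MU * MV := mul_nonneg hMU hMV
  have hmem : ∀ x ∈ Ioo (-(1 : ℝ) / 2) (1 / 2), x ∈ Ioo (-1 : ℝ) 1 := fun x hx =>
    ⟨by linarith [hx.1], by linarith [hx.2]⟩
  have h0mem : (0 : ℝ) ∈ Ioo (-(1 : ℝ) / 2) (1 / 2) := by norm_num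
  intro ψ
  set g : ℝ → ℝ := fun s => 2 * Uφ s * Vφ' s / (1 - s ^ 2)
  set h : ℝ → ℝ := fun t => ∫ s in (0 : ℝ)..t, g s with hh_def
  set H : ℝ → ℝ := fun l => ∫ t in (0 : ℝ)..l, h t
  have hg : ContinuousOn g (Ioo (-1) 1) := by
    intro x hx
    have := (one_sub_sq_pos_of_mem_Ioo hx).ne'
    exact (((continuousAt_const.mul (hUφ x hx).continuousAt).mul (hVφ' x hx).continuousAt).div
      (by fun_prop) this).continuousWithinAt
  have hgb : ∀ x ∈ Ioo (-1 : ℝ) 1, |g x| ≤ 2 * MU * MV * (1 - |x|) ^ (-(1 + 2 * ε) - 1) :=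
    fun x hx => abs_source_le hε hMU hMV hx (hbUφ x hx).1 (hbVφ x hx).2.1
  have hh := continuousOn_primitive_Ioo hg
  have hhb := abs_primitive_le hg (by linarith) (by positivity) hgb
  have hhb' : ∀ x ∈ Ioo (-1 : ℝ) 1,
      |h x| ≤ 2 * MU * MV / (1 + 2 * ε) * (1 - |x|) ^ (-(2 * ε) - 1) := by
    rwa [show -(1 + 2 * ε) = -(2 * ε) - 1 by ring] at hhb
  have hH := continuousOn_primitive_Ioo hh
  have hHb := abs_primitive_le hh (by linarith) (by positivity) hhb'
  have hψ := continuousOn_primitive_Icc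
    (intervalIntegrable_neg_one_one hH (by linarith) hHb)
  have hψlin := fun x hx =>
    abs_primitive_sub_linear_le (x := x) hH (by linarith) (by linarith) (by positivity) hHb hx
  have hKA : 2 * MU * MV / (1 + 2 * ε) / (2 * ε) / (1 - 2 * ε) = A * (MU * MV) := by
    rw [hA]; ring
  have hKA' : 2 * MU * MV / (1 + 2 * ε) / (2 * ε) ≤ A * (MU * MV) := by
    rw [← hKA]
    exact le_div_self (by positivity) hq (by linarith)
  have hhalf_h : ∀ x ∈ Ioo (-(1 : ℝ) / 2) (1 / 2), |h x| ≤ 8 * (MU * MV) := by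
    intro x hx
    have h1 := hhb x (hmem x hx)
    have h2 := one_sub_abs_rpow_neg_le (p := 1 + 2 * ε) (by linarith) (n := 2)
      (by push_cast; linarith) hx
    have h3 : 2 * MU * MV / (1 + 2 * ε) ≤ 2 * MU * MV :=
      div_le_self (by positivity) (by linarith)
    calc |h x| ≤ _ := h1
      _ ≤ 2 * MU * MV * 2 ^ 2 := mul_le_mul h3 h2
          (Real.rpow_nonneg (by linarith [abs_lt.2 (hmem x hx)]) _) (by positivity)
      _ = _ := by ring
  have hhalf_H : ∀ x ∈ Ioo (-(1 : ℝ) / 2) (1 / 2), |H x| ≤ 2 * A * (MU * MV) := by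
    intro x hx
    have h2 := one_sub_abs_rpow_neg_le (p := 2 * ε) (by linarith) (n := 1)
      (by push_cast; linarith) hx
    calc |H x| ≤ _ := hHb x (hmem x hx)
      _ ≤ A * (MU * MV) * 2 ^ 1 := mul_le_mul hKA' h2
          (Real.rpow_nonneg (by linarith [abs_lt.2 (hmem x hx)]) _) (by positivity)
      _ = _ := by ring
  have hψ1 : |ψ 1| ≤ A * (MU * MV) := by
    simpa [hKA] using abs_integral_one_sub_le hH (by linarith) hHb le_rfl one_pos
  have hψm1 : |ψ (-1)| ≤ A * (MU * MV) := by
    simpa [hKA] using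
      abs_integral_neg_one_sub_le hH (by linarith) hHb le_rfl (by norm_num : (-1 : ℝ) < 0)
  refine ⟨ψ, hψ, fun _ _ => rfl, ?_⟩
  intro Qθ Qφ
  have hUV2 : ∀ x ∈ Ioo (-(1 : ℝ) / 2) (1 / 2), HasDerivAt (fun y => Ut' y * Vt y + Ut y * Vt' y)
      (Ut'' x * Vt x + Ut' x * Vt' x + (Ut' x * Vt' x + Ut x * Vt'' x)) x := fun x hx =>
    ((hUt' x hx).mul (hVt x (hmem x hx))).add ((hUt x (hmem x hx)).mul (hVt' x hx))
  set D := deriv (deriv fun y => Ut y * Vt y) 0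
  have hD : D = Ut'' 0 * Vt 0 + Ut' 0 * Vt' 0 + (Ut' 0 * Vt' 0 + Ut 0 * Vt'' 0) :=
    (deriv_eq_and_deriv_deriv_eq isOpen_Ioo
      (fun x hx => (hUt x (hmem x hx)).mul (hVt x (hmem x hx))) hUV2 h0mem).2
  have hDb : |D| ≤ 4 * (MU * MV) := by
    have h1 := abs_le.1 (abs_mul_le_mul (hbU2 0 h0mem).1 (hV 0 (by norm_num)).2)
    have h2 := abs_le.1 (abs_mul_le_mul hU'0 hV'0)
    have h3 := abs_le.1 (abs_mul_le_mul (hU 0 (by norm_num)).2 (hbV2 0 h0mem).1)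
    rw [hD, abs_le]
    constructor <;> linarith
  have hQ1 : ∀ x ∈ Ioo (-(1 : ℝ) / 2) (1 / 2), HasDerivAt Qθ
      ((Ut' x * Vt x + Ut x * Vt' x) / 2 + H x + (ψ (-1) - ψ 1) / 2 - D * x / 2) x := by
    intro x hx
    have hx' := hmem x hx
    have hid := hasDerivAt_id' x
    have h1 := (((((hUt x hx').mul (hVt x hx')).div_const 2).add
      (hasDerivAt_primitive_of_continuousOn_Ioo hH hx')).sub
      (((hid.const_sub 1).const_mul (ψ (-1))).div_const 2)).sub
      (((hid.const_add 1).const_mul (ψ 1)).div_const 2) |>.add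
      ((((hid.pow 2).const_sub 1).const_mul D).div_const 4)
    refine h1.congr_deriv ?_
    simp
    ring
  have hQ2 : ∀ x ∈ Ioo (-(1 : ℝ) / 2) (1 / 2), HasDerivAt (fun x =>
      (Ut' x * Vt x + Ut x * Vt' x) / 2 + H x + (ψ (-1) - ψ 1) / 2 - D * x / 2)
      ((Ut'' x * Vt x + Ut' x * Vt' x + (Ut' x * Vt' x + Ut x * Vt'' x)) / 2 + h x - D / 2)
      x := by
    intro x hx
    have h1 := ((((hUV2 x hx).div_const 2).add
      (hasDerivAt_primitive_of_continuousOn_Ioo hh (hmem x hx))).add_const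
      ((ψ (-1) - ψ 1) / 2)).sub (((hasDerivAt_id' x).const_mul D).div_const 2)
    refine h1.congr_deriv ?_
    ring
  have hQd := fun x hx => deriv_eq_and_deriv_deriv_eq (x := x) isOpen_Ioo hQ1 hQ2 hx
  have hQb : ∀ x ∈ Ioo (-1 : ℝ) 1,
      |Qθ x| ≤ (4 * A + 20) * MU * MV * (1 - x ^ 2) ^ (1 - 2 * ε) := by
    intro x hx
    have hw := one_sub_sq_pos_of_mem_Ioo hx
    have hw1 : 1 - x ^ 2 ≤ 1 := by nlinarith
    set r := (1 - x ^ 2) ^ (1 - 2 * ε)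
    have hr0 : 0 ≤ r := by positivity
    have hwr : 1 - x ^ 2 ≤ r := Real.self_le_rpow_of_le_one hw.le hw1 (by linarith)
    have h1 := abs_le.1 (abs_mul_le_mul (hU x hx).1 (hV x hx).2)
    have hlin : 2 * (A * (MU * MV)) * (1 - |x|) ^ (1 - 2 * ε) ≤ 2 * (A * (MU * MV)) * r := by
      refine mul_le_mul_of_nonneg_left (Real.rpow_le_rpow ?_ ?_ hq.le) (by positivity)
      · linarith [abs_lt.2 hx]
      · exact one_sub_abs_le_one_sub_sq hx
    have h2 := hψlin x hx
    rw [hKA] at h2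
    have h2 := abs_le.1 (h2.trans hlin)
    have h3 : |D * (1 - x ^ 2)| ≤ 4 * (MU * MV) * r :=
      abs_mul_le_mul hDb (by rwa [abs_of_pos hw])
    have h3 := abs_le.1 h3
    have hMMr : 0 ≤ MU * MV * r := by positivity
    have hAr : 0 ≤ A * (MU * MV * r) := by positivity
    change |Ut x * Vt x / 2 + (∫ s in (0 : ℝ)..x, H s)
      - (∫ s in (0 : ℝ)..(-1), H s) * (1 - x) / 2
      - (∫ s in (0 : ℝ)..1, H s) * (1 + x) / 2 + D * (1 - x ^ 2) / 4| ≤ _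
    rw [abs_le]
    constructor <;> linarith
  refine ⟨tendsto_zero_of_abs_le_one_sub_sq_rpow hq (by norm_num) hQb,
    tendsto_zero_of_abs_le_one_sub_sq_rpow hq (by norm_num) hQb, ?_, ?_, ?_, ?_⟩
  · rw [(hQd 0 h0mem).2, ← hD]
    simp [hh_def]
  · intro x hx
    refine rpow_mul_le_of_le_mul_rpow_neg (one_sub_sq_pos_of_mem_Ioo hx) ?_
    rw [show -(-1 + 2 * ε) = 1 - 2 * ε by ring]
    exact hQb x hx
  · intro x hx
    have hx' := hmem x hx
    rw [(hQd x hx).1, (hQd x hx).2]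
    have h1 := abs_le.1 (abs_mul_le_mul (hU' x hx) (hV x hx').2)
    have h2 := abs_le.1 (abs_mul_le_mul (hU x hx').2 (hV' x hx))
    have h3 := abs_le.1 (abs_mul_le_mul (hbU2 x hx).1 (hV x hx').2)
    have h4 := abs_le.1 (abs_mul_le_mul (hU' x hx) (hV' x hx))
    have h5 := abs_le.1 (abs_mul_le_mul (hU x hx').2 (hbV2 x hx).1)
    have h6 := abs_le.1 (abs_mul_le_mul hDb (abs_le.2 ⟨hx'.1.le, hx'.2.le⟩ : |x| ≤ 1))
    have h7 := abs_le.1 (hhalf_H x hx)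
    have h8 := abs_le.1 (hhalf_h x hx)
    have h9 := abs_le.1 hψ1
    have h10 := abs_le.1 hψm1
    have h11 := abs_le.1 hDb
    have h12 : 0 ≤ A * (MU * MV) := by positivity
    rw [abs_le, abs_le]
    refine ⟨⟨?_, ?_⟩, ?_, ?_⟩ <;> linarith
  · intro x hx
    have hw := one_sub_sq_pos_of_mem_Ioo hx
    calc (1 - x ^ 2) ^ (1 + ε) * |Ut x * Vφ' x|
        = |Ut x| * ((1 - x ^ 2) ^ (1 + ε) * |Vφ' x|) := by rw [abs_mul]; ring
      _ ≤ MU * MV := mul_le_mul (hU x hx).2 (hbVφ x hx).2.1 (by positivity) hMU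
      _ ≤ (4 * A + 20) * MU * MV := by nlinarith [mul_nonneg hA0.le hMM]
end
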